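/- Let A_1, A_2, …, A_N be finite sets and let M be a positive integer with M < N and |A_n| ≥ M for n = 1,…,N. If there exists a perfect matching between users and resources (i.e., an injective function f on {1,…,N} with f(n) ∈ A_n for every n, a system of distinct representatives), then the number of such injective functions is at least M!. -/

import Mathlib

/-- The systems of distinct representatives of a family of finite sets. -/
def distinctReps {ι α : Type*} (A : ι → Finset α) : Set (ι → α) :=
  {f | Function.Injective f ∧ ∀ i, f i ∈ A i}

instance distinctReps.finite {ι α : Type*} [Finite ι] (A : ι → Finset α) :
    Finite (distinctReps A) :=
  Finite.of_injective (fun (f : distinctReps A) i => (⟨f.1 i, f.2.2 i⟩ : A i)) fun _ _ h =>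
    Subtype.ext <| funext fun i => congrArg Subtype.val (congrFun h i)

/-- Across a set of indices whose members have exactly as many elements as there are indices,
any partial system of distinct representatives extends to a full one. -/
theorem card_distinctReps_restrict_le {ι α : Type*} [Finite ι] [DecidableEq α]
    (A : ι → Finset α) (hA : (distinctReps A).Nonempty) (s : Finset ι)
    (hs : (s.biUnion A).card ≤ s.card) :
    Nat.card (distinctReps fun i : s => A i) ≤ Nat.card (distinctReps A) := by
  classical
  obtain ⟨f, hf, hfA⟩ := hA
  have himage : s.image f = s.biUnion A := by
    refine Finset.eq_of_subset_of_card_le ?_ ?_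
    · intro a ha
      obtain ⟨i, hi, rfl⟩ := Finset.mem_image.1 ha
      exact Finset.mem_biUnion.2 ⟨i, hi, hfA i⟩
    · rwa [Finset.card_image_of_injective _ hf]
  have hsep (g : distinctReps fun i : s => A i) (i : s) (j : ι) (hj : j ∉ s) : g.1 i ≠ f j := by
    intro h
    have hmem : g.1 i ∈ s.image f :=
      himage ▸ Finset.mem_biUnion.2 ⟨i, i.2, g.2.2 i⟩
    obtain ⟨k, hk, hkj⟩ := Finset.mem_image.1 hmem
    exact hj (hf (hkj.trans h) ▸ hk)
  let extend (g : distinctReps fun i : s => A i) : distinctReps A :=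
    ⟨fun i => if hi : i ∈ s then g.1 ⟨i, hi⟩ else f i, by
      constructor
      · intro i j hij
        by_cases hi : i ∈ s <;> by_cases hj : j ∈ s <;>
          simp only [hi, hj, dite_true, dite_false] at hij
        · exact congrArg Subtype.val (g.2.1 hij)
        · exact (hsep g ⟨i, hi⟩ j hj hij).elim
        · exact (hsep g ⟨j, hj⟩ i hi hij.symm).elim
        · exact hf hij
      · intro i
        by_cases hi : i ∈ s
        · simpa only [hi, dite_true] using g.2.2 ⟨i, hi⟩
        · simpa only [hi, dite_false] using hfA i⟩
  refine Nat.card_le_card_of_injective extend fun g h hgh => ?_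
  ext i
  simpa [extend] using congrFun (congrArg Subtype.val hgh) i

/-- Choosing the representative of one set first. -/
theorem sum_card_distinctReps_erase_le {ι α : Type*} [Finite ι] [DecidableEq α]
    (A : ι → Finset α) (i : ι) :
    ∑ a : A i, Nat.card (distinctReps fun j : {j // j ≠ i} => (A j).erase a) ≤
      Nat.card (distinctReps A) := by
  classical
  rw [← Nat.card_sigma]
  let extend (p : Σ a : A i, distinctReps fun j : {j // j ≠ i} => (A j).erase a) :
      distinctReps A :=
    ⟨fun j => if hj : j = i then p.1 else p.2.1 ⟨j, hj⟩, by
      have hne (j) : p.2.1 j ≠ p.1 := (Finset.mem_erase.1 (p.2.2.2 j)).1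
      constructor
      · intro j k hjk
        by_cases hj : j = i <;> by_cases hk : k = i <;>
          simp only [hj, hk, dite_true, dite_false] at hjk
        · exact hj.trans hk.symm
        · exact (hne _ hjk.symm).elim
        · exact (hne _ hjk).elim
        · exact congrArg Subtype.val (p.2.2.1 hjk)
      · intro j
        by_cases hj : j = i
        · subst hj
          simp
        · simpa only [hj, dite_false] using Finset.mem_of_mem_erase (p.2.2.2 ⟨j, hj⟩)⟩
  refine Nat.card_le_card_of_injective extend ?_
  rintro ⟨a, g⟩ ⟨b, h⟩ hgh
  have hval (j : ι) : (extend ⟨a, g⟩).1 j = (extend ⟨b, h⟩).1 j := by rw [hgh]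
  obtain rfl : a = b := Subtype.ext (by simpa [extend] using hval i)
  congr 1
  ext j
  simpa [extend, j.2] using hval j

/-- Marshall Hall's lower bound for the number of systems of distinct representatives. -/
theorem factorial_le_card_distinctReps {ι : Type*} {α : Type*} [Fintype ι] (A : ι → Finset α)
    (M : ℕ) (hM : M ≤ Fintype.card ι) (hcard : ∀ i, M ≤ (A i).card)
    (hA : (distinctReps A).Nonempty) : M.factorial ≤ Nat.card (distinctReps A) := by
  classical
  induction hn : Fintype.card ι using Nat.strong_induction_on generalizing ι M with
  | _ n ih =>
  have hpos : 0 < Nat.card (distinctReps A) :=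
    have := hA.to_subtype
    Nat.card_pos
  obtain _ | M := M
  · exact hpos
  have hhall : ∀ s : Finset ι, s.card ≤ (s.biUnion A).card :=
    (Finset.all_card_le_biUnion_card_iff_exists_injective A).2 hA
  by_cases hcrit : ∃ s : Finset ι, s.Nonempty ∧ s ≠ Finset.univ ∧ (s.biUnion A).card ≤ s.card
  · obtain ⟨s, ⟨i, hi⟩, hsu, hs⟩ := hcrit
    refine le_trans ?_ (card_distinctReps_restrict_le A hA s hs)
    have hlt : Fintype.card s < n := by
      rw [Fintype.card_coe, ← hn]
      exact Finset.card_lt_card (Finset.ssubset_univ_iff.2 hsu)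
    refine ih _ hlt _ _ ?_ (fun j => hcard j) ?_ rfl
    · rw [Fintype.card_coe]
      exact (hcard i).trans ((Finset.card_le_card (Finset.subset_biUnion_of_mem A hi)).trans hs)
    · obtain ⟨f, hf, hfA⟩ := hA
      exact ⟨fun j => f j, hf.comp Subtype.val_injective, fun j => hfA j⟩
  · push Not at hcrit
    obtain ⟨i⟩ : Nonempty ι := Fintype.card_pos_iff.1 (by omega)
    have hcompl : Fintype.card {j // j ≠ i} = n - 1 := by
      rw [← hn]
      simp
    have hbound (a : A i) :
        M.factorial ≤ Nat.card (distinctReps fun j : {j // j ≠ i} => (A j).erase a) := by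
      refine ih (n - 1) (by omega) _ M (by omega) (fun j => ?_) ?_ hcompl
      · have := hcard j
        have := Finset.pred_card_le_card_erase (s := A j) (a := a.1)
        omega
      · refine (Finset.all_card_le_biUnion_card_iff_exists_injective _).1 fun s => ?_
        exact HallMarriageTheorem.hall_cond_of_erase (a : α) hcrit s
    calc (M + 1).factorial = (M + 1) * M.factorial := Nat.factorial_succ M
      _ ≤ (A i).card * M.factorial := Nat.mul_le_mul_right _ (hcard i)
      _ = ∑ _a : A i, M.factorial := by simp
      _ ≤ _ := Finset.sum_le_sum fun a _ => hbound a
      _ ≤ _ := sum_card_distinctReps_erase_le A i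

/-- Marshall Hall Jr: if each of the `N` finite sets `A n` has at least `M`
elements (`M < N`), and a system of distinct representatives exists, then there are at least
`M !` systems of distinct representatives. -/
theorem stmt_11 {α : Type*} {N : ℕ} (A : Fin N → Finset α) (M : ℕ)
    (hM0 : 0 < M) (hMN : M < N) (hcard : ∀ n, M ≤ (A n).card)
    (hex : ∃ f : Fin N → α, Function.Injective f ∧ ∀ n, f n ∈ A n) :
    Nat.factorial M ≤ Nat.card {f : Fin N → α // Function.Injective f ∧ ∀ n, f n ∈ A n} := by
  exact factorial_le_card_distinctReps A M (by simpa using hMN.le) hcard hex
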